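/- arXiv:0808.3114 — 6 statements merged into one kernel-verified Lean document; each statement's English description precedes it below -/
import Mathlib

section
/- Let p be a prime and n a positive integer. If P is an elementary abelian p-subgroup of the symmetric group S_n, then |P| ≤ p^{⌊n/p⌋} (equivalently, the rank of P is at most ⌊n/p⌋). -/
/-- The order of an abelian group acting faithfully on a finite set is at most the product of the
sizes of the orbits. -/
theorem card_le_prod_card_orbit {G X : Type*} [Group G] [MulAction G X] [FaithfulSMul G X]
    [Finite X] [Fintype (MulAction.orbitRel.Quotient G X)]
    (hcomm : ∀ a b : G, a * b = b * a) :
    Nat.card G ≤ ∏ ω : MulAction.orbitRel.Quotient G X, Nat.card (MulAction.orbit G ω.out) := by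
  rw [← Nat.card_pi]
  refine Nat.card_le_card_of_injective
    (fun g ω ↦ (⟨g • ω.out, MulAction.mem_orbit _ g⟩ : MulAction.orbit G ω.out)) ?_
  intro g h hgh
  refine FaithfulSMul.eq_of_smul_eq_smul (α := X) fun x ↦ ?_
  set ω : MulAction.orbitRel.Quotient G X := Quotient.mk'' x
  have hx : x ∈ MulAction.orbit G ω.out :=
    MulAction.orbitRel_apply.mp (Quotient.exact (Quotient.out_eq ω).symm)
  obtain ⟨k, hk⟩ := hx
  have hout : g • ω.out = h • ω.out := congrArg Subtype.val (congrFun hgh ω)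
  rw [← hk]
  change g • k • ω.out = h • k • ω.out
  rw [smul_smul, smul_smul, hcomm g k, hcomm h k, mul_smul, mul_smul, hout]

theorem Nat.mul_le_pow_self {p : ℕ} (hp : 1 < p) (k : ℕ) : p * k ≤ p ^ k := by
  cases k with
  | zero => simp
  | succ k =>
    rw [pow_succ']
    exact Nat.mul_le_mul_left p (Nat.lt_pow_self hp)

/-- An abelian `p`-group acting faithfully on a finite set `X` has order at most
`p ^ ⌊|X| / p⌋`. -/
theorem IsPGroup.card_le_pow_card_div {p : ℕ} (hp : p.Prime) {G X : Type*} [Group G]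
    [MulAction G X] [FaithfulSMul G X] [Finite X] (hG : IsPGroup p G)
    (hcomm : ∀ a b : G, a * b = b * a) :
    Nat.card G ≤ p ^ (Nat.card X / p) := by
  classical
  have : Fact p.Prime := ⟨hp⟩
  have : Fintype (MulAction.orbitRel.Quotient G X) := Fintype.ofFinite _
  choose k hk using fun ω : MulAction.orbitRel.Quotient G X ↦ hG.card_orbit ω.out
  have hX : Nat.card X = ∑ ω, p ^ k ω := by
    rw [Nat.card_congr (MulAction.selfEquivSigmaOrbits G X), Nat.card_sigma]
    exact Finset.sum_congr rfl fun ω _ ↦ hk ω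
  calc Nat.card G ≤ ∏ ω, p ^ k ω := by
        simpa only [hk] using card_le_prod_card_orbit (X := X) hcomm
    _ = p ^ ∑ ω, k ω := Finset.prod_pow_eq_pow_sum _ _ _
    _ ≤ p ^ (Nat.card X / p) := by
        refine Nat.pow_le_pow_right hp.pos ((Nat.le_div_iff_mul_le hp.pos).mpr ?_)
        rw [hX, mul_comm, Finset.mul_sum]
        exact Finset.sum_le_sum fun ω _ ↦ Nat.mul_le_pow_self hp.one_lt _

/-- Let `p` be a prime and `n` a positive integer. If `P` is an elementary abelian
`p`-subgroup of the symmetric group `S_n`, then `|P| ≤ p ^ ⌊n/p⌋`. -/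
theorem stmt_0 (p n : ℕ) (hp : p.Prime) (hn : 0 < n)
    (P : Subgroup (Equiv.Perm (Fin n)))
    (habelian : ∀ a ∈ P, ∀ b ∈ P, a * b = b * a)
    (hpow : ∀ g ∈ P, g ^ p = 1) :
    Nat.card P ≤ p ^ (n / p) := by
  have hP : IsPGroup p P := fun g ↦ ⟨1, Subtype.ext (by simpa using hpow g g.2)⟩
  simpa using hP.card_le_pow_card_div (X := Fin n) hp
    fun a b ↦ Subtype.ext (habelian a a.2 b b.2)
end

section
/- Let p be a prime, Ω a finite set, and P an elementary abelian p-subgroup of Sym(Ω). For each orbit O of P on Ω, let ω_O(P) denote the subgroup of Sym(Ω) consisting of all permutations that agree with some element of P on O and fix every point of Ω outside O. Then the subgroup P̄ of Sym(Ω) generated by the union of the subgroups ω_O(P) over all orbits O is an elementary abelian p-group, P ≤ P̄, and |P̄| equals the product of the sizes of the orbits of P on Ω. -/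
namespace MulAction

variable {G α : Type*} [Group G] [MulAction G α]

theorem mk_smul_orbitRel (g : G) (a : α) :
    (Quotient.mk'' (g • a) : orbitRel.Quotient G α) = Quotient.mk'' a :=
  orbitRel.Quotient.mem_orbit.1 (by
    rw [orbitRel.Quotient.orbit_mk]
    exact mem_orbit a g)

/-- A family of group elements indexed by the orbits acts by permutations, each orbit being
moved by its own element. -/
def orbitwisePermHom (G α : Type*) [Group G] [MulAction G α] :
    (orbitRel.Quotient G α → G) →* Equiv.Perm α where
  toFun f :=
    { toFun := fun a => f (Quotient.mk'' a) • a
      invFun := fun a => (f (Quotient.mk'' a))⁻¹ • a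
      left_inv := fun a => by simp only [mk_smul_orbitRel, inv_smul_smul]
      right_inv := fun a => by simp only [mk_smul_orbitRel, smul_inv_smul] }
  map_one' := by
    ext a
    simp
  map_mul' f g := by
    ext a
    simp [mul_smul]

@[simp]
theorem orbitwisePermHom_apply (f : orbitRel.Quotient G α → G) (a : α) :
    orbitwisePermHom G α f a = f (Quotient.mk'' a) • a :=
  rfl

theorem orbitwisePermHom_eq_of_forall_out (hcomm : ∀ a b : G, a * b = b * a)
    {f g : orbitRel.Quotient G α → G}
    (h : ∀ q : orbitRel.Quotient G α, f q • q.out = g q • q.out) :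
    orbitwisePermHom G α f = orbitwisePermHom G α g := by
  ext a
  obtain ⟨k, hk⟩ : ∃ k : G, k • (Quotient.mk'' a : orbitRel.Quotient G α).out = a :=
    orbitRel_apply.1 (Quotient.exact (Quotient.out_eq _).symm)
  have := h (Quotient.mk'' a)
  simp only [orbitwisePermHom_apply]
  generalize (Quotient.mk'' a : orbitRel.Quotient G α) = q at *
  rw [← hk, ← mul_smul, ← mul_smul, hcomm, hcomm (g q), mul_smul, mul_smul, this]

theorem card_range_orbitwisePermHom [Finite α] [Fintype (orbitRel.Quotient G α)]
    (hcomm : ∀ a b : G, a * b = b * a) :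
    Nat.card (orbitwisePermHom G α).range =
      ∏ q : orbitRel.Quotient G α, q.orbit.ncard := by
  have hout : ∀ q : orbitRel.Quotient G α, (Quotient.mk'' q.out : orbitRel.Quotient G α) = q :=
    fun q => Quotient.out_eq' q
  let e : (orbitwisePermHom G α).range → ∀ q : orbitRel.Quotient G α, q.orbit := fun σ q =>
    ⟨σ.1 q.out, by
      obtain ⟨_, f, rfl⟩ := σ
      rw [orbitRel.Quotient.mem_orbit, orbitwisePermHom_apply, mk_smul_orbitRel, hout]⟩
  have he : Function.Bijective e := by
    constructor
    · rintro ⟨_, f, rfl⟩ ⟨_, g, rfl⟩ h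
      refine Subtype.ext (orbitwisePermHom_eq_of_forall_out hcomm fun q => ?_)
      have := congrArg Subtype.val (congrFun h q)
      simpa only [e, orbitwisePermHom_apply, hout] using this
    · intro t
      have ht : ∀ q : orbitRel.Quotient G α, ∃ k : G, k • q.out = (t q : α) := fun q =>
        orbitRel_apply.1 (Quotient.exact
          ((orbitRel.Quotient.mem_orbit.1 (t q).2).trans (hout q).symm))
      choose f hf using ht
      refine ⟨⟨_, f, rfl⟩, funext fun q => Subtype.ext ?_⟩
      simp only [e, orbitwisePermHom_apply, hout, hf]
  rw [Nat.card_congr (Equiv.ofBijective e he), Nat.card_pi]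
  rfl

/-- The permutations acting as a group element on one orbit and trivially elsewhere generate
the range of `orbitwisePermHom`. -/
theorem closure_eq_range_orbitwisePermHom {Ω : Type*} [Finite Ω]
    (P : Subgroup (Equiv.Perm Ω)) :
    Subgroup.closure
      (⋃ O ∈ Set.range (fun x : Ω => orbit P x),
        {σ : Equiv.Perm Ω | (∃ g ∈ P, ∀ x ∈ O, σ x = g x) ∧ ∀ x ∉ O, σ x = x}) =
      (orbitwisePermHom P Ω).range := by
  classical
  have hmem : ∀ x y : Ω,
      y ∈ orbit P x ↔ (Quotient.mk'' y : orbitRel.Quotient P Ω) = Quotient.mk'' x :=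
    fun x y => by rw [← orbitRel.Quotient.mem_orbit, orbitRel.Quotient.orbit_mk]
  apply le_antisymm
  · rw [Subgroup.closure_le]
    intro σ hσ
    simp only [Set.mem_iUnion, Set.mem_range, exists_prop] at hσ
    obtain ⟨_, ⟨x, rfl⟩, ⟨g, hg, hσg⟩, hσ⟩ := hσ
    refine ⟨Pi.mulSingle (Quotient.mk'' x) ⟨g, hg⟩, Equiv.ext fun y => ?_⟩
    rw [orbitwisePermHom_apply]
    by_cases hy : y ∈ orbit P x
    · rw [hσg y hy, (hmem x y).1 hy, Pi.mulSingle_eq_same]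
      rfl
    · rw [hσ y hy, Pi.mulSingle_eq_of_ne (mt (hmem x y).2 hy), one_smul]
  · rintro _ ⟨f, rfl⟩
    rw [← Subgroup.mem_comap]
    refine Subgroup.pi_mem_of_mulSingle_mem f fun q => Subgroup.mem_comap.2 ?_
    induction q using Quotient.inductionOn' with | h x => ?_
    refine Subgroup.subset_closure ?_
    simp only [Set.mem_iUnion, Set.mem_range, exists_prop]
    refine ⟨_, ⟨x, rfl⟩, ⟨f (Quotient.mk'' x), SetLike.coe_mem _, fun y hy => ?_⟩, fun y hy => ?_⟩
    · rw [orbitwisePermHom_apply, (hmem x y).1 hy, Pi.mulSingle_eq_same]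
      rfl
    · rw [orbitwisePermHom_apply, Pi.mulSingle_eq_of_ne (mt (hmem x y).2 hy), one_smul]

end MulAction


/-- For an elementary abelian `p`-subgroup `P` of `Sym(Ω)` (`Ω` finite), let
`ω_O(P)` be the set of permutations agreeing with some element of `P` on the orbit `O`
and fixing every point outside `O`.  The subgroup `P̄` generated by the union of the
`ω_O(P)` over all orbits `O` of `P` is elementary abelian, contains `P`, and its order
is the product of the sizes of the orbits of `P` on `Ω`. -/
theorem stmt_2 (p : ℕ) (hp : p.Prime) (Ω : Type*) [Fintype Ω]
    (P : Subgroup (Equiv.Perm Ω))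
    (habelian : ∀ a ∈ P, ∀ b ∈ P, a * b = b * a)
    (hpow : ∀ g ∈ P, g ^ p = 1) :
    ∀ Pbar : Subgroup (Equiv.Perm Ω),
      Pbar = Subgroup.closure
        (⋃ O ∈ Set.range (fun x : Ω => MulAction.orbit P x),
          {σ : Equiv.Perm Ω | (∃ g ∈ P, ∀ x ∈ O, σ x = g x) ∧ ∀ x ∉ O, σ x = x}) →
      (∀ a ∈ Pbar, ∀ b ∈ Pbar, a * b = b * a) ∧
      (∀ g ∈ Pbar, g ^ p = 1) ∧
      P ≤ Pbar ∧
      Nat.card Pbar =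
        ∏ O ∈ (Set.finite_range (fun x : Ω => MulAction.orbit P x)).toFinset, O.ncard := by
  classical
  have := Fintype.ofFinite (MulAction.orbitRel.Quotient P Ω)
  have hcomm : ∀ a b : P, a * b = b * a := fun a b => Subtype.ext (habelian a a.2 b b.2)
  rintro _ rfl
  rw [MulAction.closure_eq_range_orbitwisePermHom]
  refine ⟨?_, ?_, fun g hg => ⟨fun _ => ⟨g, hg⟩, Equiv.ext fun _ => rfl⟩, ?_⟩
  · rintro _ ⟨f, rfl⟩ _ ⟨g, rfl⟩
    rw [← map_mul, ← map_mul]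
    exact congrArg _ (funext fun q => hcomm _ _)
  · rintro _ ⟨f, rfl⟩
    rw [← map_pow, show f ^ p = 1 from funext fun q => Subtype.ext (hpow _ (f q).2), map_one]
  · rw [MulAction.card_range_orbitwisePermHom hcomm]
    refine Finset.prod_bij (fun q _ => q.orbit) (fun q _ => ?_)
      (fun _ _ _ _ h => MulAction.orbitRel.Quotient.orbit_injective h) (fun O hO => ?_)
      (fun _ _ => rfl)
    · induction q using Quotient.inductionOn' with | h x => ?_
      rw [Set.Finite.mem_toFinset]
      exact ⟨x, (MulAction.orbitRel.Quotient.orbit_mk x).symm⟩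
    · obtain ⟨x, rfl⟩ := (Set.Finite.mem_toFinset _).1 hO
      exact ⟨Quotient.mk'' x, Finset.mem_univ _, MulAction.orbitRel.Quotient.orbit_mk x⟩
end

section
/- Let p be a prime and n a positive integer. If F is a finite set of pairwise distinct subgroups of S_n, each generated by a p-cycle, such that the subgroup of S_n generated by the union of all members of F is abelian, then the supports of the members of F are pairwise disjoint and |F| ≤ ⌊n/p⌋. Moreover, if n ≥ p, then there exists such a set F with |F| = ⌊n/p⌋. (Equivalently, the p-cycle complex C_p(n) has dimension ⌊n/p⌋ − 1.) -/
open Equiv Equiv.Perm in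
/-- Commuting cycles of the same length whose supports meet generate the same subgroup. -/
lemma Equiv.Perm.IsCycle.zpowers_eq_of_commute {α : Type*} [Fintype α] [DecidableEq α]
    {c d : Perm α} (hc : c.IsCycle) (hd : d.IsCycle) (hcard : c.support.card = d.support.card)
    (hcomm : Commute c d) (hmeet : ¬ _root_.Disjoint c.support d.support) :
    Subgroup.zpowers c = Subgroup.zpowers d := by
  obtain ⟨x, hxc, hxd⟩ := Finset.not_disjoint_iff.mp hmeet
  have orbit_c : ∀ k : ℤ, (d ^ k) x ∈ c.support := fun k => by
    rw [mem_support] at hxc ⊢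
    rw [← mul_apply, (hcomm.zpow_right k).eq, mul_apply]
    exact fun h => hxc ((d ^ k).injective h)
  have hsub : d.support ⊆ c.support := fun y hy => by
    obtain ⟨k, rfl⟩ := hd.exists_zpow_eq (mem_support.mp hxd) (mem_support.mp hy)
    exact orbit_c k
  have hsupp : d.support = c.support := Finset.eq_of_subset_of_card_le hsub hcard.le
  obtain ⟨k, hk⟩ := hc.exists_zpow_eq (mem_support.mp hxc) (mem_support.mp (orbit_c 1))
  have hdk : d = c ^ k := by
    ext y
    by_cases hy : y ∈ c.support
    · obtain ⟨j, rfl⟩ := hc.exists_zpow_eq (mem_support.mp hxc) (mem_support.mp hy)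
      rw [← mul_apply, ← (hcomm.zpow_left j).eq, mul_apply, ← mul_apply (c ^ k), ← zpow_add,
        add_comm, zpow_add, mul_apply, hk, zpow_one]
    · rw [notMem_support.mp (hsupp ▸ hy),
        notMem_support.mp fun h => hy (support_zpow_le c k h)]
  refine (Subgroup.eq_of_le_of_card_ge ?_ ?_).symm
  · rw [hdk]
    exact Subgroup.zpowers_le.mpr (Subgroup.zpow_mem_zpowers c k)
  · rw [Nat.card_zpowers, Nat.card_zpowers, hc.orderOf, hd.orderOf, hcard]

/-- Elements of a subgroup generated by pairwise commuting elements commute. -/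
lemma Subgroup.mul_comm_of_mem_closure {G : Type*} [Group G] {s : Set G}
    (hs : ∀ a ∈ s, ∀ b ∈ s, a * b = b * a) :
    ∀ a ∈ Subgroup.closure s, ∀ b ∈ Subgroup.closure s, a * b = b * a := by
  intro a ha b hb
  have hle : Subgroup.closure s ≤ Subgroup.centralizer (Subgroup.closure s) := by
    rw [Subgroup.centralizer_closure, Subgroup.closure_le]
    exact fun x hx => by
      simpa [Subgroup.mem_centralizer_iff] using fun y hy => hs y hy x hx
  exact (Subgroup.mem_centralizer_iff.mp (hle hb)) a ha


/-- If `F` is a finite set of subgroups of `S_n`, each generated by a `p`-cycle, such that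
the subgroup generated by the union of the members of `F` is abelian, then the supports of
the members of `F` are pairwise disjoint and `|F| ≤ ⌊n/p⌋`.  Moreover, if `n ≥ p` then some
such `F` has `|F| = ⌊n/p⌋` (i.e. the `p`-cycle complex `C_p(n)` has dimension `⌊n/p⌋ - 1`). -/
theorem stmt_5 (p n : ℕ) (hp : p.Prime) (hn : 0 < n) :
    (∀ F : Finset (Subgroup (Equiv.Perm (Fin n))),
      (∀ Q ∈ F, ∃ c : Equiv.Perm (Fin n),
          c.IsCycle ∧ c.support.card = p ∧ Q = Subgroup.zpowers c) →
      (∀ a ∈ Subgroup.closure (⋃ Q ∈ F, (Q : Set (Equiv.Perm (Fin n)))),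
        ∀ b ∈ Subgroup.closure (⋃ Q ∈ F, (Q : Set (Equiv.Perm (Fin n)))),
          a * b = b * a) →
      ((∀ Q ∈ F, ∀ Q' ∈ F, Q ≠ Q' →
          ∀ c c' : Equiv.Perm (Fin n),
            c.IsCycle → c.support.card = p → Q = Subgroup.zpowers c →
            c'.IsCycle → c'.support.card = p → Q' = Subgroup.zpowers c' →
            Disjoint c.support c'.support) ∧
        F.card ≤ n / p)) ∧
    (p ≤ n →
      ∃ F : Finset (Subgroup (Equiv.Perm (Fin n))),
        (∀ Q ∈ F, ∃ c : Equiv.Perm (Fin n),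
            c.IsCycle ∧ c.support.card = p ∧ Q = Subgroup.zpowers c) ∧
        (∀ a ∈ Subgroup.closure (⋃ Q ∈ F, (Q : Set (Equiv.Perm (Fin n)))),
          ∀ b ∈ Subgroup.closure (⋃ Q ∈ F, (Q : Set (Equiv.Perm (Fin n)))),
            a * b = b * a) ∧
        F.card = n / p) := by
  refine ⟨fun F hF hab => ?_, fun _ => ?_⟩
  · have hdisj : ∀ Q ∈ F, ∀ Q' ∈ F, Q ≠ Q' → ∀ c c' : Equiv.Perm (Fin n),
        c.IsCycle → c.support.card = p → Q = Subgroup.zpowers c →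
        c'.IsCycle → c'.support.card = p → Q' = Subgroup.zpowers c' →
        Disjoint c.support c'.support := by
      rintro Q hQ Q' hQ' hne c c' hc hcp rfl hc' hcp' rfl
      by_contra hmeet
      refine hne (hc.zpowers_eq_of_commute hc' (hcp.trans hcp'.symm) ?_ hmeet)
      exact hab c (Subgroup.subset_closure
          (Set.mem_biUnion hQ (Subgroup.mem_zpowers c)))
        c' (Subgroup.subset_closure (Set.mem_biUnion hQ' (Subgroup.mem_zpowers c')))
    refine ⟨hdisj, (Nat.le_div_iff_mul_le hp.pos).mpr ?_⟩
    choose! c hc hcp hQc using hF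
    calc F.card * p = ∑ Q ∈ F, (c Q).support.card := by
          rw [Finset.sum_congr rfl hcp, Finset.sum_const, smul_eq_mul]
      _ = (F.biUnion fun Q => (c Q).support).card := by
          refine (Finset.card_biUnion fun Q hQ Q' hQ' hne => ?_).symm
          exact hdisj Q hQ Q' hQ' hne _ _ (hc Q hQ) (hcp Q hQ) (hQc Q hQ)
            (hc Q' hQ') (hcp Q' hQ') (hQc Q' hQ')
      _ ≤ n := (Finset.card_le_univ _).trans_eq (Fintype.card_fin n)
  · classical
    obtain ⟨σ, hσ⟩ := (Equiv.Perm.exists_with_cycleType_iff (α := Fin n)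
      (m := Multiset.replicate (n / p) p)).mpr ⟨by
        simpa using Nat.div_mul_le_self n p, fun a ha => by
        rw [Multiset.eq_of_mem_replicate ha]; exact hp.two_le⟩
    have hcycle : ∀ c ∈ σ.cycleFactorsFinset, c.IsCycle ∧ c.support.card = p := by
      intro c hc
      refine ⟨(Equiv.Perm.mem_cycleFactorsFinset_iff.mp hc).1, ?_⟩
      have hmem : c.support.card ∈ σ.cycleType := by
        rw [Equiv.Perm.cycleType_def]
        exact Multiset.mem_map_of_mem _ hc
      rw [hσ] at hmem
      exact Multiset.eq_of_mem_replicate hmem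
    refine ⟨σ.cycleFactorsFinset.image Subgroup.zpowers, ?_, ?_, ?_⟩
    · simp only [Finset.forall_mem_image]
      exact fun c hc => ⟨c, (hcycle c hc).1, (hcycle c hc).2, rfl⟩
    · refine Subgroup.mul_comm_of_mem_closure fun a ha b hb => ?_
      simp only [Finset.mem_image, Set.iUnion_exists, Set.biUnion_and', Set.iUnion_iUnion_eq_right,
        Set.mem_iUnion, SetLike.mem_coe, Subgroup.mem_zpowers_iff] at ha hb
      obtain ⟨c, hc, k, rfl⟩ := ha
      obtain ⟨d, hd, l, rfl⟩ := hb
      exact ((Equiv.Perm.cycleFactorsFinset_mem_commute σ).of_refl hc hd).zpow_zpow k l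
    · rw [Finset.card_image_of_injOn]
      · have h := congrArg Multiset.card hσ
        simpa [Equiv.Perm.cycleType_def] using h
      · intro c hc d hd hcd
        by_contra hne
        obtain ⟨x, hx⟩ := (hcycle c hc).1.nonempty_support
        obtain ⟨k, hk⟩ := Subgroup.mem_zpowers_iff.mp
          (hcd ▸ Subgroup.mem_zpowers c : c ∈ Subgroup.zpowers d)
        have hdisj := (Equiv.Perm.cycleFactorsFinset_pairwise_disjoint σ hc hd hne).disjoint_support
        exact Finset.disjoint_left.mp hdisj hx (Equiv.Perm.support_zpow_le d k (hk ▸ hx))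
end

section
/- Let p be a prime, n a positive integer, and t = ⌊n/p⌋. Suppose P is a nontrivial elementary abelian p-subgroup of S_n such that no subgroup of S_n generated by t pairwise disjoint p-cycles contains P. Then p^p · |P| ≤ p^{t+2}, i.e., the rank of P is at most t − (p − 2). -/
open Equiv.Perm MulAction

/-- A set of pairwise disjoint `p`-cycles extends to one of any size `m` with `p * m` at most the
number of points. -/
theorem exists_disjoint_cycles_extension {α : Type*} [Fintype α] [DecidableEq α] {p m : ℕ}
    (hp : 2 ≤ p) (hm : m * p ≤ Fintype.card α) (C : Finset (Equiv.Perm α))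
    (hC : ∀ c ∈ C, c.IsCycle ∧ c.support.card = p)
    (hdisj : (C : Set (Equiv.Perm α)).PairwiseDisjoint support) (hcard : C.card ≤ m) :
    ∃ D : Finset (Equiv.Perm α), C ⊆ D ∧ D.card = m ∧
      (∀ c ∈ D, c.IsCycle ∧ c.support.card = p) ∧
      (D : Set (Equiv.Perm α)).PairwiseDisjoint support := by
  obtain ⟨k, hk⟩ := Nat.exists_eq_add_of_le hcard
  induction k generalizing C with
  | zero => exact ⟨C, subset_rfl, by omega, hC, hdisj⟩
  | succ k ih =>
    have hU : (C.biUnion support).card = C.card * p := by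
      rw [Finset.card_biUnion hdisj, Finset.sum_congr rfl fun c hc => (hC c hc).2]
      simp
    have hfree : p ≤ (C.biUnion support)ᶜ.card := by
      rw [Finset.card_compl, hU]
      have : (C.card + 1) * p ≤ m * p := Nat.mul_le_mul_right _ (by omega)
      rw [add_mul, one_mul] at this
      omega
    obtain ⟨s, hs, hsp⟩ := Finset.exists_subset_card_eq hfree
    have hcyc : s.toList.formPerm.IsCycle :=
      List.isCycle_formPerm s.nodup_toList (by simpa [hsp] using hp)
    have hsupp : s.toList.formPerm.support = s := by
      rw [List.support_formPerm_of_nodup _ s.nodup_toList, Finset.toList_toFinset]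
      intro x hx
      have := congrArg List.length hx
      simp at this
      omega
    have hdis : ∀ c ∈ C, Disjoint s c.support := fun c hc =>
      (Finset.disjoint_left.2 fun x hx hxc =>
        (Finset.mem_compl.1 (hs hx)) (Finset.mem_biUnion.2 ⟨c, hc, hxc⟩))
    have hnot : s.toList.formPerm ∉ C := fun h => by
      have := hdis _ h
      rw [hsupp, disjoint_self] at this
      simp [this] at hsp
      omega
    obtain ⟨D, hCD, hD⟩ := ih (insert s.toList.formPerm C)
      (by
        intro c hc
        rcases Finset.mem_insert.1 hc with rfl | hc
        · exact ⟨hcyc, by rw [hsupp, hsp]⟩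
        · exact hC c hc)
      (by
        rw [Finset.coe_insert]
        refine hdisj.insert fun c hc _ => ?_
        rw [hsupp]
        exact hdis c hc)
      (by rw [Finset.card_insert_of_notMem hnot]; omega)
      (by rw [Finset.card_insert_of_notMem hnot]; omega)
    exact ⟨D, (Finset.subset_insert _ _).trans hCD, hD⟩

/-- A finite abelian permutation group is no larger than the product of its orbit sizes. -/
theorem card_le_prod_card_orbit_s6 {α : Type*} [Fintype α]
    (P : Subgroup (Equiv.Perm α)) (habelian : ∀ a ∈ P, ∀ b ∈ P, a * b = b * a)
    [Fintype (orbitRel.Quotient P α)] :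
    Nat.card P ≤ ∏ ω : orbitRel.Quotient P α, Nat.card (orbit P ω.out) := by
  rw [← Nat.card_pi]
  refine Nat.card_le_card_of_injective
    (fun (g : P) (ω : orbitRel.Quotient P α) => (⟨g • ω.out, mem_orbit _ g⟩ : orbit P ω.out)) ?_
  intro g h hgh
  ext x
  have hx : x ∈ orbit P (Quotient.out (Quotient.mk (orbitRel P α) x)) :=
    (orbitRel P α).symm (Quotient.mk_out (s := orbitRel P α) x)
  obtain ⟨k, hk⟩ := hx
  have h1 := congrArg Subtype.val (congrFun hgh (Quotient.mk (orbitRel P α) x))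
  have hcomm : ∀ a : P, a * k = k * a := fun a => Subtype.ext (habelian _ a.2 _ k.2)
  change g • x = h • x
  rw [← hk]
  simp only [smul_smul, hcomm]
  simp only [← smul_smul]
  exact congrArg (k • ·) h1

theorem add_le_pow_pred_add_two {p a : ℕ} (hp : 2 ≤ p) (ha : 2 ≤ a) :
    p + a ≤ p ^ (a - 1) + 2 := by
  obtain ⟨b, rfl⟩ := Nat.exists_eq_add_of_le ha
  induction b with
  | zero => simp
  | succ b ih =>
    have ih := ih (by omega)
    have e : 2 + (b + 1) - 1 = (2 + b - 1) + 1 := by omega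
    have h1 : 1 ≤ p ^ (2 + b - 1) := Nat.one_le_pow _ _ (by omega)
    rw [e, pow_succ]
    nlinarith

theorem le_pow_pred {p a : ℕ} (hp : 2 ≤ p) (ha : 1 ≤ a) : a ≤ p ^ (a - 1) := by
  have := Nat.lt_pow_self (n := a - 1) hp
  omega

/-- If `n` is a sum of powers of `p`, one of them at least `p ^ 2`, then the sum of the exponents is
at most `n / p - (p - 2)`. -/
theorem add_sum_exponents_le {ι : Type*} [Fintype ι] {p n : ℕ} (hp : 2 ≤ p) (a : ι → ℕ)
    (hsum : ∑ i, p ^ a i = n) {j : ι} (hj : 2 ≤ a j) : p + ∑ i, a i ≤ n / p + 2 := by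
  classical
  set b : ι → ℕ := fun i => if a i = 0 then 0 else p ^ (a i - 1) with hb
  have hab : ∀ i, a i ≤ b i := fun i => by
    by_cases h : a i = 0
    · simp [hb, h]
    · simpa [hb, h] using le_pow_pred hp (Nat.one_le_iff_ne_zero.2 h)
  have hbn : ∑ i, b i ≤ n / p := by
    rw [Nat.le_div_iff_mul_le (by omega), Finset.sum_mul, ← hsum]
    refine Finset.sum_le_sum fun i _ => ?_
    by_cases h : a i = 0
    · simp [hb, h]
    · simp only [hb, h, if_false, ← pow_succ]
      rw [Nat.sub_add_cancel (Nat.one_le_iff_ne_zero.2 h)]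
  have hbj : p + a j ≤ b j + 2 := by
    simpa [hb, show a j ≠ 0 by omega] using add_le_pow_pred_add_two hp hj
  have hrest : ∑ i ∈ Finset.univ.erase j, a i ≤ ∑ i ∈ Finset.univ.erase j, b i :=
    Finset.sum_le_sum fun i _ => hab i
  rw [← Finset.add_sum_erase _ _ (Finset.mem_univ j)] at hbn ⊢
  omega

/-- An element of prime exponent `p` moving a point of an orbit with `p` elements acts on that
orbit as a `p`-cycle. -/
theorem coe_support_cycleOf_eq_orbit {α : Type*} [Fintype α] [DecidableEq α] {p : ℕ}
    (hp : p.Prime) {P : Subgroup (Equiv.Perm α)} {g : Equiv.Perm α} (hg : g ∈ P) (hgp : g ^ p = 1)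
    {x : α} (hx : g x ≠ x) (horb : Nat.card (orbit P x) = p) :
    ((g.cycleOf x).support : Set α) = orbit P x ∧ (g.cycleOf x).support.card = p := by
  have hcard : (g.cycleOf x).support.card = p := by
    rw [← (isCycle_cycleOf g hx).orderOf]
    have hdvd := (orderOf_cycleOf_dvd_orderOf g x).trans (orderOf_dvd_of_pow_eq_one hgp)
    refine (hp.eq_one_or_self_of_dvd _ hdvd).resolve_left fun h => ?_
    rw [orderOf_eq_one_iff, cycleOf_eq_one_iff] at h
    exact hx h
  refine ⟨Set.eq_of_subset_of_ncard_le ?_ ?_, hcard⟩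
  · intro y hy
    obtain ⟨k, hk⟩ := (mem_support_cycleOf_iff.1 (Finset.mem_coe.1 hy)).1
    exact ⟨⟨g ^ k, P.zpow_mem hg k⟩, hk⟩
  · rw [Set.ncard_coe_finset, hcard, ← horb]
    rfl

/-- In an abelian permutation group of prime exponent `p`, any two elements moving a point of an
orbit with `p` elements restrict to powers of each other on that orbit. -/
theorem cycleOf_mem_zpowers_cycleOf {α : Type*} [Fintype α] [DecidableEq α] {p : ℕ}
    (hp : p.Prime) {P : Subgroup (Equiv.Perm α)} (habelian : ∀ a ∈ P, ∀ b ∈ P, a * b = b * a)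
    (hpow : ∀ g ∈ P, g ^ p = 1) {g h : Equiv.Perm α} (hg : g ∈ P) (hh : h ∈ P)
    {x : α} (hgx : g x ≠ x) (hhx : h x ≠ x) (horb : Nat.card (orbit P x) = p) :
    h.cycleOf x ∈ Subgroup.zpowers (g.cycleOf x) := by
  obtain ⟨hgs, -⟩ := coe_support_cycleOf_eq_orbit hp hg (hpow g hg) hgx horb
  obtain ⟨hhs, -⟩ := coe_support_cycleOf_eq_orbit hp hh (hpow h hh) hhx horb
  have hsup : (h.cycleOf x).support = (g.cycleOf x).support :=
    Finset.coe_injective (hhs.trans hgs.symm)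
  have hmem : h x ∈ (g.cycleOf x).support := by
    rw [← hsup, mem_support_cycleOf_iff' hhx]
    exact sameCycle_apply_right.2 (SameCycle.refl h x)
  obtain ⟨k, hk⟩ := (mem_support_cycleOf_iff' hgx).1 hmem
  refine ⟨k, Equiv.ext fun y => ?_⟩
  by_cases hy : y ∈ (g.cycleOf x).support
  · have hgy := (mem_support_cycleOf_iff' hgx).1 hy
    have hhy := (mem_support_cycleOf_iff' hhx).1 (hsup ▸ hy)
    change (g.cycleOf x ^ k) y = _
    rw [hhy.cycleOf_apply, hgy.cycleOf_eq, cycleOf_zpow_apply_self]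
    obtain ⟨j, rfl⟩ := hgy
    have e := congrArg (· x) (habelian _ (P.zpow_mem hg j) _ hh)
    simp only [mul_apply] at e
    rw [← e, ← hk, ← mul_apply, ← mul_apply, ← zpow_add, ← zpow_add, add_comm]
  · rw [notMem_support.1 (hsup ▸ hy : y ∉ (h.cycleOf x).support)]
    exact notMem_support.1 fun h' => hy (support_zpow_le _ _ h')

/-- An abelian permutation group of prime exponent `p` all of whose orbits have at most `p` elements
is contained in a group generated by disjoint `p`-cycles. -/
theorem exists_disjoint_cycles_of_card_orbit {α : Type*} [Fintype α] [DecidableEq α] {p : ℕ}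
    (hp : p.Prime) {P : Subgroup (Equiv.Perm α)} (habelian : ∀ a ∈ P, ∀ b ∈ P, a * b = b * a)
    (hpow : ∀ g ∈ P, g ^ p = 1)
    (horb : ∀ x : α, Nat.card (orbit P x) = 1 ∨ Nat.card (orbit P x) = p) :
    ∃ C : Finset (Equiv.Perm α), (∀ c ∈ C, c.IsCycle ∧ c.support.card = p) ∧
      (C : Set (Equiv.Perm α)).PairwiseDisjoint support ∧
      P ≤ Subgroup.closure (C : Set (Equiv.Perm α)) := by
  classical
  have hfix : ∀ x : α, Nat.card (orbit P x) = 1 → ∀ g ∈ P, g x = x := fun x hx g hg => by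
    have := (Nat.card_eq_one_iff_unique.1 hx).1
    exact congrArg Subtype.val (Subsingleton.elim
      (⟨g x, mem_orbit x (⟨g, hg⟩ : P)⟩ : orbit P x) ⟨x, mem_orbit_self x⟩)
  have hmove : ∀ x : α, Nat.card (orbit P x) = p → ∃ g ∈ P, g x ≠ x := fun x hx => by
    by_contra! hcon
    have : orbit P x = {x} := by
      ext y
      constructor
      · rintro ⟨g, rfl⟩
        exact hcon g g.2
      · rintro rfl
        exact mem_orbit_self _
    rw [this] at hx
    simp at hx
    exact hp.one_lt.ne hx
  choose! γ hγP hγ using hmove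
  set r : α → α := fun x => Quotient.out (Quotient.mk (orbitRel P α) x) with hr
  have hro : ∀ x, orbit P (r x) = orbit P x := fun x =>
    orbit_eq_iff.2 (Quotient.mk_out (s := orbitRel P α) x)
  set c : α → Equiv.Perm α := fun x => (γ (r x)).cycleOf (r x) with hc
  have hcs : ∀ x, Nat.card (orbit P x) = p →
      ((c x).support : Set α) = orbit P x ∧ (c x).support.card = p := fun x hx => by
    rw [← hro] at hx ⊢
    exact coe_support_cycleOf_eq_orbit hp (hγP _ hx) (hpow _ (hγP _ hx)) (hγ _ hx) hx
  refine ⟨(Finset.univ.filter fun x => Nat.card (orbit P x) = p).image c, ?_, ?_, ?_⟩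
  · simp only [Finset.mem_image, Finset.mem_filter, Finset.mem_univ, true_and]
    rintro _ ⟨x, hx, rfl⟩
    exact ⟨isCycle_cycleOf _ (hγ _ (hro x ▸ hx)), (hcs x hx).2⟩
  · intro c₁ h₁ c₂ h₂ hne
    simp only [Finset.mem_coe, Finset.mem_image, Finset.mem_filter, Finset.mem_univ,
      true_and] at h₁ h₂
    obtain ⟨x, hx, rfl⟩ := h₁
    obtain ⟨y, hy, rfl⟩ := h₂
    refine Finset.disjoint_left.2 fun z hzx hzy => hne ?_
    rw [← Finset.mem_coe, (hcs x hx).1] at hzx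
    rw [← Finset.mem_coe, (hcs y hy).1] at hzy
    have hxy : Quotient.mk (orbitRel P α) x = Quotient.mk (orbitRel P α) y :=
      Quotient.sound (orbit_eq_iff.1 ((orbit_eq_iff.2 hzx).symm.trans (orbit_eq_iff.2 hzy)))
    simp only [hc, hr, hxy]
  · intro h hh
    rw [← cycleFactorsFinset_noncommProd h]
    refine Subgroup.noncommProd_mem _ _ fun d hd => ?_
    obtain ⟨x, hx⟩ := (mem_cycleFactorsFinset_iff.1 hd).1.nonempty_support
    have hhx : h x ≠ x := mem_support.1 (mem_cycleFactorsFinset_support_le hd hx)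
    have hxp : Nat.card (orbit P x) = p := (horb x).resolve_left fun h1 => hhx (hfix x h1 h hh)
    have hrx : Nat.card (orbit P (r x)) = p := hro x ▸ hxp
    have hxc : (γ (r x)).SameCycle (r x) x := by
      rw [← mem_support_cycleOf_iff' (hγ _ hrx), ← Finset.mem_coe]
      exact (hcs x hxp).1 ▸ mem_orbit_self x
    have hγx : γ (r x) x ≠ x := fun h1 => hγ _ hrx (hxc.apply_eq_self_iff.2 h1)
    have hz : d ∈ Subgroup.zpowers (c x) := by
      rw [cycle_is_cycleOf hx hd]
      simp only [hc]
      rw [hxc.cycleOf_eq]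
      exact cycleOf_mem_zpowers_cycleOf hp habelian hpow (hγP _ hrx) hh hγx hhx hxp
    refine (Subgroup.zpowers_le.2 (Subgroup.subset_closure ?_)) hz
    simp only [Finset.mem_coe, Finset.mem_image, Finset.mem_filter, Finset.mem_univ, true_and]
    exact ⟨x, hxp, rfl⟩


/-- Let `t = ⌊n/p⌋`.  If `P` is a nontrivial elementary abelian `p`-subgroup of `S_n`
not contained in any subgroup generated by `t` pairwise disjoint `p`-cycles, then
`p^p * |P| ≤ p^(t+2)`, i.e. the rank of `P` is at most `t - (p - 2)`. -/
theorem stmt_6 (p n : ℕ) (hp : p.Prime) (hn : 0 < n)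
    (P : Subgroup (Equiv.Perm (Fin n))) (hP : P ≠ ⊥)
    (habelian : ∀ a ∈ P, ∀ b ∈ P, a * b = b * a)
    (hpow : ∀ g ∈ P, g ^ p = 1)
    (hno : ¬ ∃ c : Fin (n / p) → Equiv.Perm (Fin n),
        (∀ i, (c i).IsCycle ∧ (c i).support.card = p) ∧
        (∀ i j, i ≠ j → Disjoint (c i).support (c j).support) ∧
        P ≤ Subgroup.closure (Set.range c)) :
    p ^ p * Nat.card P ≤ p ^ (n / p + 2) := by
  classical
  have : Fact p.Prime := ⟨hp⟩
  have hPp : IsPGroup p P := fun g => ⟨1, Subtype.ext (by simpa using hpow g g.2)⟩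
  choose a ha using fun x : Fin n => hPp.card_orbit x
  by_cases hbig : ∃ x, 2 ≤ a x
  · obtain ⟨x, hx⟩ := hbig
    have hout : a (Quotient.mk (orbitRel P (Fin n)) x).out = a x := by
      refine Nat.pow_right_injective hp.two_le ?_
      change p ^ _ = p ^ _
      rw [← ha, ← ha, orbit_eq_iff.2 (Quotient.mk_out (s := orbitRel P (Fin n)) x)]
    have hsum : ∑ ω : orbitRel.Quotient P (Fin n), p ^ a ω.out = n := by
      have := Nat.card_congr (selfEquivSigmaOrbits P (Fin n))
      rw [Nat.card_sigma, Nat.card_fin] at this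
      simp only [← ha]
      exact this.symm
    have hle := add_sum_exponents_le hp.two_le (fun ω : orbitRel.Quotient P (Fin n) => a ω.out)
      hsum (j := Quotient.mk (orbitRel P (Fin n)) x) (by simpa only [hout] using hx)
    calc p ^ p * Nat.card P
        ≤ p ^ p * ∏ ω : orbitRel.Quotient P (Fin n), Nat.card (orbit P ω.out) :=
          Nat.mul_le_mul_left _ (card_le_prod_card_orbit_s6 P habelian)
      _ = p ^ (p + ∑ ω : orbitRel.Quotient P (Fin n), a ω.out) := by
          simp only [ha, Finset.prod_pow_eq_pow_sum, pow_add]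
      _ ≤ p ^ (n / p + 2) := Nat.pow_le_pow_right hp.pos hle
  · push Not at hbig
    obtain ⟨C, hC, hdisj, hPC⟩ := exists_disjoint_cycles_of_card_orbit hp habelian hpow fun x => by
      have := hbig x
      rw [ha]
      interval_cases a x <;> simp
    have hcard : C.card ≤ n / p := by
      rw [Nat.le_div_iff_mul_le hp.pos, ← smul_eq_mul,
        ← Finset.sum_const, ← Finset.sum_congr rfl fun c hc => (hC c hc).2,
        ← Finset.card_biUnion hdisj]
      simpa using Finset.card_le_univ (C.biUnion support)
    obtain ⟨D, hCD, hDcard, hD, hDdisj⟩ := exists_disjoint_cycles_extension hp.two_le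
      (by simpa using Nat.div_mul_le_self n p) C hC hdisj hcard
    have e : Fin (n / p) ≃ D := (D.equivFinOfCardEq hDcard).symm
    refine absurd ⟨fun i => e i, fun i => hD _ (e i).2, fun i j hij => ?_, ?_⟩ hno
    · exact hDdisj (e i).2 (e j).2 fun h => hij (e.injective (Subtype.ext h))
    · refine hPC.trans (Subgroup.closure_mono fun c hc => ?_)
      exact ⟨e.symm ⟨c, hCD hc⟩, by simp⟩
end

section
/- Let p be a prime and let c_1,…,c_t be p-cycles in S_n with pairwise disjoint supports, and set P = ⟨c_1,…,c_t⟩. If q ∈ P and q = q_1 q_2 ⋯ q_m, where q_1,…,q_m are p-cycles with pairwise disjoint supports, then q_i ∈ P for every i ∈ {1,…,m}. -/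
theorem Equiv.Perm.exists_zpow_eqOn_support_of_mem_closure {ι α : Type*} [DecidableEq α] [Fintype α]
    {c : ι → Equiv.Perm α} (hc : ∀ i j, i ≠ j → (c i).Disjoint (c j))
    {g : Equiv.Perm α} (hg : g ∈ Subgroup.closure (Set.range c)) :
    (∀ x, (∀ i, x ∉ (c i).support) → g x = x) ∧
      ∀ i, ∃ k : ℤ, ∀ x ∈ (c i).support, g x = (c i ^ k) x := by
  induction hg using Subgroup.closure_induction with
  | mem g hg =>
    obtain ⟨j, rfl⟩ := hg
    refine ⟨fun x hx => Equiv.Perm.notMem_support.1 (hx j), fun i => ?_⟩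
    by_cases h : i = j
    · subst h
      exact ⟨1, fun x _ => by simp⟩
    · exact ⟨0, fun x hx => by
        simpa using (hc i j h x).resolve_left (Equiv.Perm.mem_support.1 hx)⟩
  | one => exact ⟨fun x _ => rfl, fun i => ⟨0, fun x _ => by simp⟩⟩
  | mul g h _ _ hg hh =>
    refine ⟨fun x hx => by rw [Equiv.Perm.mul_apply, hh.1 x hx, hg.1 x hx], fun i => ?_⟩
    obtain ⟨k, hk⟩ := hg.2 i
    obtain ⟨l, hl⟩ := hh.2 i
    refine ⟨k + l, fun x hx => ?_⟩
    rw [Equiv.Perm.mul_apply, hl x hx, hk _ (Equiv.Perm.zpow_apply_mem_support.2 hx), zpow_add,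
      Equiv.Perm.mul_apply]
  | inv g _ hg =>
    refine ⟨fun x hx => Equiv.Perm.inv_eq_iff_eq.2 (hg.1 x hx).symm, fun i => ?_⟩
    obtain ⟨k, hk⟩ := hg.2 i
    refine ⟨-k, fun x hx => Equiv.Perm.inv_eq_iff_eq.2 ?_⟩
    rw [hk _ (Equiv.Perm.zpow_apply_mem_support.2 hx), ← Equiv.Perm.mul_apply, ← zpow_add]
    simp

theorem Equiv.Perm.IsCycle.isCycle_zpow_of_prime {α : Type*} [DecidableEq α] [Fintype α]
    {c : Equiv.Perm α} (hc : c.IsCycle) (hp : c.support.card.Prime) {k : ℤ} (hk : c ^ k ≠ 1) :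
    (c ^ k).IsCycle := by
  rw [← hc.orderOf] at hp
  obtain ⟨l, hl⟩ := (isOfFinOrder_of_finite c).mem_powers_iff_mem_zpowers.2 ⟨k, rfl⟩
  change c ^ l = c ^ k at hl
  rw [← hl] at hk ⊢
  refine hc.pow_iff.2 (((Nat.Prime.coprime_iff_not_dvd hp).2 fun h => hk ?_).symm)
  exact orderOf_dvd_iff_pow_eq_one.1 h


/-- Let `c_1, …, c_t` be `p`-cycles in `S_n` with pairwise disjoint supports and let
`P = ⟨c_1, …, c_t⟩`.  If `q ∈ P` and `q = q_1 ⋯ q_m` where the `q_i` are `p`-cycles with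
pairwise disjoint supports, then every `q_i` lies in `P`. -/
theorem stmt_7 (p n t m : ℕ) (hp : p.Prime)
    (c : Fin t → Equiv.Perm (Fin n))
    (hc : ∀ i, (c i).IsCycle ∧ (c i).support.card = p)
    (hcdisj : ∀ i j, i ≠ j → Disjoint (c i).support (c j).support)
    (q : Equiv.Perm (Fin n)) (hq : q ∈ Subgroup.closure (Set.range c))
    (qs : Fin m → Equiv.Perm (Fin n))
    (hqs : ∀ i, (qs i).IsCycle ∧ (qs i).support.card = p)
    (hqsdisj : ∀ i j, i ≠ j → Disjoint (qs i).support (qs j).support)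
    (hprod : q = (List.ofFn qs).prod) :
    ∀ i, qs i ∈ Subgroup.closure (Set.range c) := by
  intro i
  have hcd : ∀ i j, i ≠ j → (c i).Disjoint (c j) := fun i j h =>
    Equiv.Perm.disjoint_iff_disjoint_support.2 (hcdisj i j h)
  have hpw : (List.ofFn qs).Pairwise Equiv.Perm.Disjoint := List.pairwise_ofFn.2 fun i j h =>
    Equiv.Perm.disjoint_iff_disjoint_support.2 (hqsdisj i j h.ne)
  have hqi : ∀ x ∈ (qs i).support, qs i x = q x := by
    rw [hprod]
    exact Equiv.Perm.eq_on_support_mem_disjoint (List.mem_ofFn.2 ⟨i, rfl⟩) hpw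
  obtain ⟨hfix, hpow⟩ := Equiv.Perm.exists_zpow_eqOn_support_of_mem_closure hcd hq
  obtain ⟨x, hx⟩ := (hqs i).1.nonempty_support
  have hqx : q x ≠ x := hqi x hx ▸ Equiv.Perm.mem_support.1 hx
  obtain ⟨j, hj⟩ : ∃ j, x ∈ (c j).support := by
    by_contra! h
    exact hqx (hfix x h)
  obtain ⟨k, hk⟩ := hpow j
  have hkx : (c j ^ k) x ≠ x := hk x hj ▸ hqx
  have hcyc : (c j ^ k).IsCycle := (hc j).1.isCycle_zpow_of_prime ((hc j).2.symm ▸ hp)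
    fun h => hkx (by rw [h, Equiv.Perm.one_apply])
  have hcq : c j ^ k ∈ q.cycleFactorsFinset := Equiv.Perm.mem_cycleFactorsFinset_iff.2
    ⟨hcyc, fun y hy => (hk y (Equiv.Perm.support_zpow_le _ _ hy)).symm⟩
  have hqq : qs i ∈ q.cycleFactorsFinset :=
    Equiv.Perm.mem_cycleFactorsFinset_iff.2 ⟨(hqs i).1, hqi⟩
  rw [Equiv.Perm.cycle_is_cycleOf hx hqq,
    ← Equiv.Perm.cycle_is_cycleOf (Equiv.Perm.mem_support.2 hkx) hcq]
  exact Subgroup.zpow_mem _ (Subgroup.subset_closure (Set.mem_range_self j)) k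
end

section
/- Let p be a prime, n a positive integer, and let (P_i)_{i∈I} be a nonempty family of subgroups of S_n such that each P_i is generated by a set of p-cycles with pairwise disjoint supports. Then the intersection Q = ⋂_{i∈I} P_i is generated by the set of p-cycles contained in Q. -/
namespace Equiv.Perm

variable {α : Type*} [Fintype α] [DecidableEq α]

/-- On the support of each of finitely many disjoint permutations, an element of the group they
generate agrees with a power of that permutation; outside the supports it is the identity. -/
theorem exists_pow_eq_of_mem_closure_disjoint {S : Set (Perm α)}
    (hS : S.Pairwise fun c c' => _root_.Disjoint c.support c'.support)
    {g : Perm α} (hg : g ∈ Subgroup.closure S) :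
    (∀ c ∈ S, ∃ k : ℤ, ∀ x ∈ c.support, g x = (c ^ k) x) ∧
      ∀ x, (∀ c ∈ S, x ∉ c.support) → g x = x := by
  induction hg using Subgroup.closure_induction with
  | mem c hc =>
    refine ⟨fun c' hc' => ?_, fun x hx => notMem_support.1 (hx c hc)⟩
    by_cases h : c' = c
    · exact ⟨1, fun x _ => by simp [h]⟩
    · exact ⟨0, fun x hx => by
        simpa using notMem_support.1 (Finset.disjoint_left.1 (hS hc' hc h) hx)⟩
  | one => exact ⟨fun c _ => ⟨0, fun x _ => by simp⟩, fun x _ => rfl⟩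
  | mul g h _ _ ihg ihh =>
    refine ⟨fun c hc => ?_, fun x hx => by rw [mul_apply, ihh.2 x hx, ihg.2 x hx]⟩
    obtain ⟨k, hk⟩ := ihg.1 c hc
    obtain ⟨l, hl⟩ := ihh.1 c hc
    refine ⟨k + l, fun x hx => ?_⟩
    rw [mul_apply, hl x hx, hk _ (zpow_apply_mem_support.2 hx), zpow_add, mul_apply]
  | inv g _ ih =>
    refine ⟨fun c hc => ?_, fun x hx => inv_eq_iff_eq.2 (ih.2 x hx).symm⟩
    obtain ⟨k, hk⟩ := ih.1 c hc
    refine ⟨-k, fun x hx => inv_eq_iff_eq.2 ?_⟩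
    rw [hk _ (zpow_apply_mem_support.2 hx), ← mul_apply, ← zpow_add]
    simp

/-- The cycle factors of an element of a group generated by disjoint `p`-cycles, with `p` prime,
are `p`-cycles of that group. -/
theorem mem_closure_of_mem_cycleFactorsFinset {p : ℕ} (hp : p.Prime) {S : Set (Perm α)}
    (hc : ∀ c ∈ S, c.IsCycle ∧ c.support.card = p)
    (hS : S.Pairwise fun c c' => _root_.Disjoint c.support c'.support)
    {g d : Perm α} (hg : g ∈ Subgroup.closure S) (hd : d ∈ g.cycleFactorsFinset) :
    d ∈ Subgroup.closure S ∧ d.support.card = p := by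
  obtain ⟨hpow, hfix⟩ := exists_pow_eq_of_mem_closure_disjoint hS hg
  obtain ⟨hdc, hdg⟩ := mem_cycleFactorsFinset_iff.1 hd
  obtain ⟨x, hx⟩ := hdc.nonempty_support
  have hgx : g x ≠ x := hdg x hx ▸ mem_support.1 hx
  obtain ⟨c, hcS, hxc⟩ : ∃ c ∈ S, x ∈ c.support := by
    by_contra! h
    exact hgx (hfix x h)
  obtain ⟨hcyc, hcard⟩ := hc c hcS
  obtain ⟨k, hk⟩ := hpow c hcS
  obtain ⟨m, hm⟩ : c ^ k ∈ Submonoid.powers c :=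
    mem_powers_iff_mem_zpowers.2 ⟨k, rfl⟩
  simp only at hm
  have hne : c ^ m ≠ 1 := fun h => hgx (by rw [hk x hxc, ← hm, h, one_apply])
  have hord : orderOf c = p := hcyc.orderOf.trans hcard
  have hcop : m.Coprime (orderOf c) := by
    rw [hord, Nat.coprime_comm, hp.coprime_iff_not_dvd, ← hord, orderOf_dvd_iff_pow_eq_one]
    exact hne
  have hsupp : (c ^ m).support = c.support := support_pow_coprime hcop
  have hmem : c ^ m ∈ g.cycleFactorsFinset :=
    mem_cycleFactorsFinset_iff.2 ⟨hcyc.pow_iff.2 hcop, fun y hy => by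
      rw [hk y (hsupp ▸ hy), ← hm]⟩
  have hdeq : d = c ^ m := by
    by_contra h
    exact Finset.disjoint_left.1
      (g.cycleFactorsFinset_pairwise_disjoint hd hmem h).disjoint_support hx (hsupp ▸ hxc)
  rw [hdeq, hsupp]
  exact ⟨pow_mem (Subgroup.subset_closure hcS) m, hcard⟩

end Equiv.Perm


/-- If each member of a nonempty family `(P_i)` of subgroups of `S_n` is generated by a set
of `p`-cycles with pairwise disjoint supports, then the intersection `Q = ⋂ P_i` is
generated by the set of `p`-cycles contained in `Q`. -/
theorem stmt_8 (p n : ℕ) (hp : p.Prime) (I : Type*) [Nonempty I]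
    (P : I → Subgroup (Equiv.Perm (Fin n)))
    (hP : ∀ i, ∃ S : Set (Equiv.Perm (Fin n)),
        (∀ c ∈ S, c.IsCycle ∧ c.support.card = p) ∧
        (S.Pairwise fun c c' => Disjoint c.support c'.support) ∧
        P i = Subgroup.closure S) :
    (⨅ i, P i) = Subgroup.closure
      {c : Equiv.Perm (Fin n) | c ∈ (⨅ i, P i) ∧ c.IsCycle ∧ c.support.card = p} := by
  refine le_antisymm (fun g hg => ?_) ((Subgroup.closure_le _).2 fun c hc => hc.1)
  have hfactor : ∀ d ∈ g.cycleFactorsFinset, ∀ i, d ∈ P i ∧ d.support.card = p := by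
    intro d hd i
    obtain ⟨S, hS, hdisj, hPS⟩ := hP i
    rw [hPS]
    exact Equiv.Perm.mem_closure_of_mem_cycleFactorsFinset hp hS hdisj
      (hPS ▸ Subgroup.mem_iInf.1 hg i) hd
  rw [← g.cycleFactorsFinset_noncommProd]
  refine Subgroup.noncommProd_mem _ _ fun d hd => Subgroup.subset_closure ⟨?_, ?_, ?_⟩
  · exact Subgroup.mem_iInf.2 fun i => (hfactor d hd i).1
  · exact (Equiv.Perm.mem_cycleFactorsFinset_iff.1 hd).1
  · exact (hfactor d hd (Classical.arbitrary I)).2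
end
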